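/- Distributional Fourier transform of the finite-part power Pf x^{−n−1}: For every nonnegative integer n and every Schwartz function φ : ℝ → ℂ with Fourier transform φ̂(k) = ∫_ℝ φ(x)e^{−ikx}dx, one has lim_{ε→0⁺} ∫_{|x|>ε} φ̂^{(n)}(x)/x dx = π·(−i)^{n+1} · ∫_ℝ x^n·sgn(x)·φ(x) dx, where φ̂^{(n)} is the n-th derivative of φ̂ and sgn is the sign function. -/

import Mathlib

open MeasureTheory Filter Real

/-- The Fourier transform `φ̂(k) = ∫ φ(x) e^{−ikx} dx` of a Schwartz function. -/
noncomputable def fourierT (φ : SchwartzMap ℝ ℂ) (k : ℝ) : ℂ :=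
  ∫ x : ℝ, φ x * Complex.exp (-Complex.I * (k : ℂ) * (x : ℂ))

open scoped FourierTransform SchwartzMap

/-- An integrable continuous function vanishing at `0` and differentiable there stays integrable
after division by the variable. -/
lemma integrable_div_ofReal {g : ℝ → ℂ} (hg : Integrable g) (hc : Continuous g)
    (hd : DifferentiableAt ℝ g 0) (h0 : g 0 = 0) : Integrable (fun x : ℝ => g x / (x : ℂ)) := by
  have hcont : Continuous (dslope g 0) := by
    rw [← continuousOn_univ, continuousOn_dslope univ_mem]
    exact ⟨hc.continuousOn, hd⟩
  have hmeas : AEStronglyMeasurable (fun x : ℝ => g x / (x : ℂ)) :=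
    (hc.measurable.div Complex.measurable_ofReal).aestronglyMeasurable
  rw [← integrableOn_univ, ← Set.union_compl_self (Set.Icc (-1 : ℝ) 1), integrableOn_union]
  constructor
  · refine (hcont.integrableOn_Icc.norm).mono' hmeas.restrict (ae_of_all _ fun x => ?_)
    rcases eq_or_ne x 0 with rfl | hx
    · simp
    · rw [dslope_of_ne _ hx, slope_def_module]
      simp [h0, div_eq_inv_mul]
  · refine (hg.norm.integrableOn).mono' hmeas.restrict
      ((ae_restrict_iff' measurableSet_Icc.compl).2 (ae_of_all _ fun x hx => ?_))
    have hx1 : 1 ≤ |x| := by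
      by_contra! h
      exact hx (abs_le.1 h.le)
    rw [norm_div, Complex.norm_real, Real.norm_eq_abs]
    exact div_le_self (norm_nonneg _) hx1

/-- The principal value integral of `g x / x` is the integral of the odd part of `g`
divided by `x`. -/
lemma tendsto_principalValue {g : ℝ → ℂ} (hg : Integrable g) (hd : Differentiable ℝ g) :
    Tendsto (fun ε : ℝ => ∫ x in {x : ℝ | ε < |x|}, g x / (x : ℂ)) (nhdsWithin 0 (Set.Ioi 0))
      (nhds (∫ x : ℝ, (g x - g (-x)) / 2 / (x : ℂ))) := by
  have hodd : Integrable (fun x : ℝ => (g x - g (-x)) / 2 / (x : ℂ)) := by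
    refine integrable_div_ofReal ((hg.sub hg.comp_neg).div_const 2) ?_ ?_ (by simp)
    · have := hd.continuous
      fun_prop
    · have : Differentiable ℝ (fun x : ℝ => (g x - g (-x)) / 2) := by fun_prop
      exact this 0
  have hms (ε : ℝ) : MeasurableSet {x : ℝ | ε < |x|} :=
    measurableSet_lt measurable_const measurable_id.abs
  have heq : ∀ ε ∈ Set.Ioi (0 : ℝ), ∫ x in {x : ℝ | ε < |x|}, (g x - g (-x)) / 2 / (x : ℂ) =
      ∫ x in {x : ℝ | ε < |x|}, g x / (x : ℂ) := by
    intro ε hε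
    have hint : IntegrableOn (fun x : ℝ => g x / (x : ℂ)) {x : ℝ | ε < |x|} := by
      refine ((hg.norm.const_mul ε⁻¹).integrableOn).mono'
        (hd.continuous.measurable.div Complex.measurable_ofReal).aestronglyMeasurable
        ((ae_restrict_iff' (hms ε)).2 (ae_of_all _ fun x hx => ?_))
      rw [norm_div, Complex.norm_real, Real.norm_eq_abs, div_eq_inv_mul]
      have hε' : 0 < ε := hε
      have hx' : ε < |x| := hx
      gcongr
    rw [← integral_indicator (hms ε), ← integral_indicator (hms ε)]
    rw [← integrable_indicator_iff (hms ε)] at hint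
    set G := Set.indicator {x : ℝ | ε < |x|} (fun x : ℝ => g x / (x : ℂ)) with hG
    have : Set.indicator {x : ℝ | ε < |x|} (fun x : ℝ => (g x - g (-x)) / 2 / (x : ℂ)) =
        fun x => (G x + G (-x)) / 2 := by
      ext x
      by_cases hx : ε < |x|
      · simp [hG, Set.indicator, hx, div_neg]
        ring
      · simp [hG, Set.indicator, hx]
    rw [this, integral_div, integral_add hint hint.comp_neg, integral_neg_eq_self]
    ring
  refine Tendsto.congr' (eventually_mem_nhdsWithin.mono heq) ?_
  simp_rw [← fun ε => integral_indicator (μ := volume)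
    (f := fun x : ℝ => (g x - g (-x)) / 2 / (x : ℂ)) (hms ε)]
  refine tendsto_integral_filter_of_dominated_convergence _
    (Eventually.of_forall fun ε => hodd.aestronglyMeasurable.indicator (hms ε))
    (Eventually.of_forall fun ε => ae_of_all _ fun x => norm_indicator_le_norm_self _ _)
    hodd.norm (ae_of_all _ fun x => ?_)
  refine tendsto_const_nhds.congr' ?_
  rcases eq_or_ne x 0 with rfl | hx
  · exact Eventually.of_forall fun ε => by simp [Set.indicator]
  · filter_upwards [nhdsWithin_le_nhds (Iio_mem_nhds (abs_pos.2 hx))] with ε hε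
    rw [Set.indicator_of_mem]
    exact hε

/-- The primitive `t ↦ ∫_{-∞}^t f` of an odd Schwartz function is integrable. -/
lemma integrable_setIntegral_Iic_of_odd (f : 𝓢(ℝ, ℂ)) (hodd : ∀ x, f (-x) = -f x)
    (hcont : Continuous fun t : ℝ => ∫ s in Set.Iic t, f s) :
    Integrable (fun t : ℝ => ∫ s in Set.Iic t, f s) := by
  have hzero : ∫ s, f s = 0 := by
    have h := integral_neg_eq_self (fun s => f s) volume
    simp_rw [hodd, integral_neg] at h
    exact self_eq_neg.1 h.symm
  have heven (t : ℝ) : ∫ s in Set.Iic (-t), f s = ∫ s in Set.Iic t, f s := by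
    have h := integral_comp_neg_Ioi t (fun s => f s)
    have h' := intervalIntegral.integral_Iic_add_Ioi (b := t)
      f.integrable.integrableOn f.integrable.integrableOn (μ := volume)
    simp_rw [hodd, integral_neg] at h
    rw [← h, neg_eq_iff_add_eq_zero, add_comm, h', hzero]
  have hI : Integrable (fun s : ℝ => (1 + s ^ 2) * ‖f s‖) := by
    refine (f.integrable.norm.add (f.integrable_pow_mul volume 2)).congr (ae_of_all _ fun s => ?_)
    simp [add_mul]
  set M := ∫ s : ℝ, (1 + s ^ 2) * ‖f s‖
  have hbound : ∀ t ≤ (0 : ℝ), ‖∫ s in Set.Iic t, f s‖ ≤ M * (1 + t ^ 2)⁻¹ := by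
    intro t ht
    have hpos : 0 < 1 + t ^ 2 := by positivity
    rw [← div_eq_mul_inv, le_div_iff₀ hpos]
    calc ‖∫ s in Set.Iic t, f s‖ * (1 + t ^ 2)
        ≤ (∫ s in Set.Iic t, ‖f s‖) * (1 + t ^ 2) := by
          gcongr
          exact norm_integral_le_integral_norm _
      _ = ∫ s in Set.Iic t, (1 + t ^ 2) * ‖f s‖ := by rw [integral_const_mul, mul_comm]
      _ ≤ ∫ s in Set.Iic t, (1 + s ^ 2) * ‖f s‖ := by
          refine setIntegral_mono_on (f.integrable.norm.const_mul _).integrableOn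
            hI.integrableOn measurableSet_Iic fun s hs => ?_
          have hs' : s ≤ t := hs
          have : t ^ 2 ≤ s ^ 2 := by nlinarith
          gcongr
      _ ≤ M := setIntegral_le_integral hI (ae_of_all _ fun s => by positivity)
  refine (integrable_inv_one_add_sq.const_mul M).mono' hcont.aestronglyMeasurable
    (ae_of_all _ fun t => ?_)
  rcases le_total t 0 with ht | ht
  · exact hbound t ht
  · simpa [heven] using hbound (-t) (neg_nonpos.2 ht)

/-- For an odd Schwartz function `f`, `∫ 𝓕 f w / w dw` is `2πi` times the integral of `f` over
the negative half-line. -/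
lemma integral_fourier_div_of_odd (f : 𝓢(ℝ, ℂ)) (hodd : ∀ x, f (-x) = -f x) :
    ∫ w : ℝ, 𝓕 f w / (w : ℂ) = 2 * π * Complex.I * ∫ s in Set.Iic (0 : ℝ), f s := by
  set χ : ℝ → ℂ := fun t => ∫ s in Set.Iic t, f s
  have hderiv (t : ℝ) : HasDerivAt χ (f t) t := by
    have h : χ = fun t => (∫ s in Set.Iic (0 : ℝ), f s) + ∫ s in (0 : ℝ)..t, f s := by
      ext t
      rw [← intervalIntegral.integral_Iic_sub_Iic f.integrable.integrableOn
        f.integrable.integrableOn, add_sub_cancel]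
    rw [h]
    exact (f.continuous.integral_hasStrictDerivAt 0 t).hasDerivAt.const_add _
  have hdiff : Differentiable ℝ χ := fun t => (hderiv t).differentiableAt
  have hd : deriv χ = f := funext fun t => (hderiv t).deriv
  have hint : Integrable χ := integrable_setIntegral_Iic_of_odd f hodd hdiff.continuous
  have hF : ∀ w : ℝ, 𝓕 f w = (2 * π * Complex.I * w) * 𝓕 χ w := by
    intro w
    have h := congrFun (Real.fourier_deriv hint hdiff (hd ▸ f.integrable)) w
    rw [hd] at h
    simpa [SchwartzMap.fourier_coe] using h
  have hc : (2 * π * Complex.I : ℂ) ≠ 0 := by simp [Real.pi_ne_zero]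
  have hae : (fun w : ℝ => 𝓕 f w / (w : ℂ)) =ᵐ[volume] fun w => 2 * π * Complex.I * 𝓕 χ w := by
    filter_upwards [compl_mem_ae_iff.2 (measure_singleton (0 : ℝ))] with w hw
    have hw' : (w : ℂ) ≠ 0 := by simpa using hw
    rw [hF]
    field_simp
  have hFint : Integrable (𝓕 χ) := by
    have h := (integrable_div_ofReal (𝓕 f).integrable (𝓕 f).continuous
      (𝓕 f).differentiableAt (by simp [hF])).congr hae
    exact (integrable_const_mul_iff (IsUnit.mk0 _ hc) _).1 h
  have hinv := hint.fourierInv_fourier_eq hFint (v := 0) hdiff.continuous.continuousAt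
  rw [Real.fourierInv_eq] at hinv
  rw [integral_congr_ae hae, integral_const_mul, show (∫ s in Set.Iic (0 : ℝ), f s) = χ 0 from rfl, ← hinv]
  simp

/-- The odd part of a Schwartz function. -/
noncomputable def SchwartzMap.oddPart (f : 𝓢(ℝ, ℂ)) : 𝓢(ℝ, ℂ) :=
  (2⁻¹ : ℂ) • (f - SchwartzMap.compCLMOfContinuousLinearEquiv ℂ (ContinuousLinearEquiv.neg ℝ) f)

lemma SchwartzMap.oddPart_apply (f : 𝓢(ℝ, ℂ)) (x : ℝ) : f.oddPart x = (f x - f (-x)) / 2 := by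
  simp [oddPart, div_eq_inv_mul]

lemma SchwartzMap.fourier_oddPart (f : 𝓢(ℝ, ℂ)) (w : ℝ) :
    𝓕 f.oddPart w = (𝓕 f w - 𝓕 f (-w)) / 2 := by
  have h : ∫ v : ℝ, 𝐞 (-(v * w)) • f (-v) = ∫ v : ℝ, 𝐞 (-(v * -w)) • f v := by
    rw [← integral_neg_eq_self]
    simp
  have hi : Integrable fun v : ℝ => 𝐞 (-(v * w)) • f v := by
    simpa [mul_comm w] using (Real.fourierIntegral_convergent_iff (μ := volume) (f := f) w).2 f.integrable
  have hi' : Integrable fun v : ℝ => 𝐞 (-(v * w)) • f (-v) := by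
    simpa [mul_comm w] using (Real.fourierIntegral_convergent_iff (μ := volume) (f := fun v => f (-v)) w).2
      f.integrable.comp_neg
  simp only [SchwartzMap.fourier_coe, Real.fourier_real_eq]
  rw [← h, ← integral_sub hi hi', ← integral_div]
  congr with v
  simp only [oddPart_apply, Circle.smul_def, smul_eq_mul]
  ring

lemma SchwartzMap.setIntegral_Iic_oddPart (f : 𝓢(ℝ, ℂ)) :
    ∫ s in Set.Iic (0 : ℝ), f.oddPart s = -(∫ x : ℝ, (Real.sign x : ℂ) * f x) / 2 := by
  have h1 : ∫ s in Set.Iic (0 : ℝ), f (-s) = ∫ s in Set.Ioi (0 : ℝ), f s := by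
    simp
  have hsi : Integrable fun x : ℝ => (Real.sign x : ℂ) * f x := by
    refine f.integrable.norm.mono' ?_ (ae_of_all _ fun x => ?_)
    · refine AEStronglyMeasurable.mul ?_ f.continuous.aestronglyMeasurable
      have : Measurable Real.sign := by
        unfold Real.sign
        exact Measurable.ite measurableSet_Iio measurable_const
          (Measurable.ite measurableSet_Ioi measurable_const measurable_const)
      exact (Complex.measurable_ofReal.comp this).aestronglyMeasurable
    · rcases Real.sign_apply_eq x with h | h | h <;> simp [h]
  have h2 : ∫ x : ℝ, (Real.sign x : ℂ) * f x =
      (∫ s in Set.Ioi (0 : ℝ), f s) - ∫ s in Set.Iic (0 : ℝ), f s := by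
    rw [← intervalIntegral.integral_Iic_add_Ioi (b := (0 : ℝ)) hsi.integrableOn hsi.integrableOn,
      setIntegral_congr_fun (g := f) measurableSet_Ioi
        (fun x hx => by simp [Real.sign_of_pos hx]),
      integral_Iic_eq_integral_Iio, setIntegral_congr_fun (g := fun x => -f x) measurableSet_Iio
        (fun x hx => by simp [Real.sign_of_neg hx]), integral_neg, integral_Iic_eq_integral_Iio]
    ring
  simp_rw [oddPart_apply]
  rw [integral_div, integral_sub f.integrable.integrableOn f.integrable.comp_neg.integrableOn,
    h1, h2]
  ring

lemma fourierT_eq_fourier (φ : 𝓢(ℝ, ℂ)) (k : ℝ) : fourierT φ k = 𝓕 φ ((2 * π)⁻¹ * k) := by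
  rw [SchwartzMap.fourier_coe, Real.fourier_real_eq_integral_exp_smul, fourierT]
  congr with x
  rw [smul_eq_mul, mul_comm]
  congr 2
  push_cast
  have : (π : ℂ) ≠ 0 := by simp [Real.pi_ne_zero]
  field_simp

lemma tendsto_principalValue_fourierT (ψ : 𝓢(ℝ, ℂ)) :
    Tendsto (fun ε : ℝ => ∫ x in {x : ℝ | ε < |x|}, fourierT ψ x / (x : ℂ))
      (nhdsWithin 0 (Set.Ioi 0))
      (nhds (π * -Complex.I * ∫ x : ℝ, (Real.sign x : ℂ) * ψ x)) := by
  set c : ℝ := (2 * π)⁻¹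
  have hc0 : 0 < c := by positivity
  have hT : fourierT ψ = fun k => 𝓕 ψ (c * k) := funext fun k => fourierT_eq_fourier ψ k
  have hdiff : Differentiable ℝ (fourierT ψ) := by
    rw [hT]
    exact (𝓕 ψ).differentiable.comp (differentiable_id.const_mul c)
  have hint : Integrable (fourierT ψ) := by
    rw [hT]
    exact (𝓕 ψ).integrable.comp_mul_left' hc0.ne'
  convert tendsto_principalValue hint hdiff using 2
  have hscale : (fun x : ℝ => (fourierT ψ x - fourierT ψ (-x)) / 2 / (x : ℂ)) =
      fun x => c • (fun w : ℝ => 𝓕 ψ.oddPart w / (w : ℂ)) (c * x) := by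
    ext x
    have : (c : ℂ) ≠ 0 := by simpa using hc0.ne'
    simp only [hT, SchwartzMap.fourier_oddPart, Complex.real_smul, mul_neg]
    push_cast
    field_simp
  rw [hscale, integral_smul, Measure.integral_comp_mul_left (fun w : ℝ => 𝓕 ψ.oddPart w / (w : ℂ)) c, abs_of_pos (inv_pos.2 hc0),
    smul_inv_smul₀ hc0.ne', integral_fourier_div_of_odd, SchwartzMap.setIntegral_Iic_oddPart]
  · ring
  · intro x
    simp only [SchwartzMap.oddPart_apply, neg_neg]
    ring

lemma iteratedDeriv_fourierT (n : ℕ) (φ : 𝓢(ℝ, ℂ)) :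
    ∃ ψ : 𝓢(ℝ, ℂ), (∀ x : ℝ, ψ x = (-Complex.I * x) ^ n * φ x) ∧
      iteratedDeriv n (fourierT φ) = fourierT ψ := by
  have htg : Function.HasTemperateGrowth fun x : ℝ => (-Complex.I * (x : ℂ)) ^ n := by fun_prop
  refine ⟨SchwartzMap.smulLeftCLM ℂ (fun x : ℝ => (-Complex.I * (x : ℂ)) ^ n) φ,
    fun x => by rw [SchwartzMap.smulLeftCLM_apply_apply htg, smul_eq_mul], ?_⟩
  ext k
  rw [funext (fourierT_eq_fourier φ),
    iteratedDeriv_comp_const_smul ((𝓕 φ).smooth n) (2 * π)⁻¹]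
  simp only [SchwartzMap.fourier_coe]
  rw [Real.iteratedDeriv_fourier (N := ⊤) _ le_top, fourierT_eq_fourier, SchwartzMap.fourier_coe,
    SchwartzMap.smulLeftCLM_apply htg]
  · simp only [Real.fourier_real_eq]
    rw [← integral_smul]
    congr with v
    have : (π : ℂ) ≠ 0 := by simp [Real.pi_ne_zero]
    simp only [Circle.smul_def, smul_eq_mul, Complex.real_smul]
    push_cast
    have h : (-Complex.I * (v : ℂ)) ^ n
        = (2 * (π : ℂ))⁻¹ ^ n * (-2 * π * Complex.I * v) ^ n := by
      rw [← mul_pow]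
      field_simp
    rw [h]
    ring
  · intro m _
    rw [← integrable_norm_iff (by have := φ.continuous; fun_prop)]
    simpa [norm_smul] using φ.integrable_pow_mul volume m

/-- Distributional Fourier transform of the finite-part power `Pf x^{−n−1}`:
`lim_{ε→0⁺} ∫_{|x|>ε} φ̂^{(n)}(x)/x dx = π(−i)^{n+1} ∫ x^n sgn(x) φ(x) dx`. -/
theorem fourier_finite_part_power (n : ℕ) (φ : SchwartzMap ℝ ℂ) :
    Tendsto
      (fun ε : ℝ => ∫ x in {x : ℝ | ε < |x|},
        iteratedDeriv n (fourierT φ) x / (x : ℂ))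
      (nhdsWithin 0 (Set.Ioi 0))
      (nhds ((π : ℂ) * (-Complex.I) ^ (n + 1) *
        ∫ x : ℝ, ((x ^ n * Real.sign x : ℝ) : ℂ) * φ x)) := by
  obtain ⟨ψ, hψ, hd⟩ := iteratedDeriv_fourierT n φ
  rw [hd]
  convert tendsto_principalValue_fourierT ψ using 2
  rw [pow_succ', ← mul_assoc, mul_assoc, ← integral_const_mul]
  congr with x
  rw [hψ]
  push_cast
  ring
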